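/- Let λ ∈ [0,1) and let F be a λ-regular CDF with density on [a,b) ⊆ [0,∞) such that the maximum of n i.i.d. draws from F is integrable. Let n ≥ k ≥ 1 be integers with k dividing n, s = n/k, and p = E[v^{(1,s)}]. Then k·p·(1 − F(p)^s) ≥ c(λ)·(1 − 1/e)·∑_{j=1}^k E[v^{(j,n)}]. (This is the improved bound of the Corollary to Theorem 1 when n/k is an integer: the Intermediary-Proof Mechanism's revenue, divided by τ, is at least c(λ)·(1 − 1/e) times the expected optimal welfare.) -/

import Mathlib

open MeasureTheory Filter

/-- The `j`-th largest value (1-indexed) among the `t` coordinates of `v`. -/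
noncomputable def orderStat (t j : ℕ) (v : Fin t → ℝ) : ℝ :=
  ((List.ofFn v).insertionSort (· ≤ ·)).getD (t - j) 0

/-- The expectation of the `j`-th largest of `t` i.i.d. draws from `μ`. -/
noncomputable def orderStatExp (μ : Measure ℝ) (j t : ℕ) : ℝ :=
  ∫ v, orderStat t j v ∂(Measure.pi fun _ : Fin t => μ)

/-- `F` is a CDF with density `f` on `[a, b)` (where possibly `b = ∞`):
differentiable with positive derivative `f` there, `F a = 0`, `F` nondecreasing,
and `F x → 1` as `x → b`. -/
def IsCDF (F f : ℝ → ℝ) (a : ℝ) (b : EReal) : Prop :=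
  (a : EReal) < b ∧ Monotone F ∧ F a = 0 ∧
  (∀ x : ℝ, a ≤ x → (x : EReal) < b → HasDerivAt F (f x) x ∧ 0 < f x) ∧
  Tendsto F (Filter.comap (fun x : ℝ => (x : EReal)) (nhdsWithin b (Set.Iio b))) (nhds 1)

/-- `μ` is the probability measure on `[a, b)` induced by the CDF `F`. -/
def InducedBy (μ : Measure ℝ) (F : ℝ → ℝ) (a : ℝ) (b : EReal) : Prop :=
  IsProbabilityMeasure μ ∧
  ∀ x : ℝ, a ≤ x → (x : EReal) < b → μ (Set.Iic x) = ENNReal.ofReal (F x)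

/-- `λ`-regularity of the CDF `F` with density `f` on `[a, b)`. -/
def LambdaRegular (l : ℝ) (F f : ℝ → ℝ) (a : ℝ) (b : EReal) : Prop :=
  MonotoneOn (fun v => l * v - (1 - F v) / f v) {x : ℝ | a ≤ x ∧ (x : EReal) < b}

/-- `c(λ) = (1 - λ)^(1/λ)` for `λ ∈ (0,1]`, with `c(0) = 1/e`. -/
noncomputable def cReg (l : ℝ) : ℝ := if l = 0 then (Real.exp 1)⁻¹ else (1 - l) ^ (1 / l)

section OrderStatistics

lemma le_orderStat_one {t : ℕ} (v : Fin t → ℝ) (i : Fin t) : v i ≤ orderStat t 1 v := by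
  set l := (List.ofFn v).insertionSort (· ≤ ·) with hl
  have hlen : l.length = t := by simp [hl]
  have hmem : v i ∈ l := by simp [hl, List.mem_insertionSort]
  obtain ⟨m, hm, hmv⟩ := List.getElem_of_mem hmem
  have hlt : t - 1 < l.length := by have := i.2; omega
  have hsort : List.Pairwise (· ≤ ·) l := List.pairwise_insertionSort _ _
  have : orderStat t 1 v = l[t - 1] := List.getD_eq_getElem _ _ hlt
  rw [this, ← hmv]
  exact List.Pairwise.rel_get_of_le hsort (a := ⟨m, hm⟩) (b := ⟨t - 1, hlt⟩)
    (by simp only [Fin.mk_le_mk]; omega)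

lemma exists_orderStat_one_eq {t : ℕ} (ht : 1 ≤ t) (v : Fin t → ℝ) :
    ∃ i, orderStat t 1 v = v i := by
  set l := (List.ofFn v).insertionSort (· ≤ ·) with hl
  have hlen : l.length = t := by simp [hl]
  have hlt : t - 1 < l.length := by omega
  have h : orderStat t 1 v = l[t - 1] := List.getD_eq_getElem _ _ hlt
  have hmem : l[t - 1] ∈ List.ofFn v := (List.mem_insertionSort _).1 (List.getElem_mem hlt)
  obtain ⟨i, hi⟩ := (List.mem_ofFn' v _).1 hmem
  exact ⟨i, by rw [h, ← hi]⟩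

lemma orderStat_one_preimage_Iic {t : ℕ} (ht : 1 ≤ t) (x : ℝ) :
    orderStat t 1 ⁻¹' Set.Iic x = Set.univ.pi fun _ : Fin t => Set.Iic x := by
  ext v
  simp only [Set.mem_preimage, Set.mem_Iic, Set.mem_pi, Set.mem_univ, true_implies]
  refine ⟨fun h i => (le_orderStat_one v i).trans h, fun h => ?_⟩
  obtain ⟨i, hi⟩ := exists_orderStat_one_eq ht v
  exact hi ▸ h i

lemma measurable_orderStat_one {t : ℕ} (ht : 1 ≤ t) : Measurable (orderStat t 1) := by
  refine measurable_of_Iic fun x => ?_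
  rw [orderStat_one_preimage_Iic ht]
  exact MeasurableSet.univ_pi fun _ => measurableSet_Iic

lemma sum_comp_orderStat (t : ℕ) (g : ℝ → ℝ) (v : Fin t → ℝ) :
    ∑ j ∈ Finset.Icc 1 t, g (orderStat t j v) = ∑ i, g (v i) := by
  set l := (List.ofFn v).insertionSort (· ≤ ·) with hl
  have hlen : l.length = t := by simp [hl]
  have h1 : ∑ i, g (v i) = (l.map g).sum := by
    rw [((List.perm_insertionSort (· ≤ ·) (List.ofFn v)).map g).sum_eq, List.map_ofFn,
      List.sum_ofFn]
    rfl
  have h2 : (l.map g).sum = ∑ i ∈ Finset.range t, g (l.getD i 0) := by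
    rw [← Fin.sum_univ_fun_getElem, ← hlen, Finset.sum_range]
    exact Finset.sum_congr rfl fun i _ => by rw [List.getD_eq_getElem _ _ i.2]
  rw [h1, h2]
  refine Finset.sum_nbij' (fun j => t - j) (fun i => t - i) ?_ ?_ ?_ ?_ fun _ _ => rfl
  · intro j hj; simp at hj ⊢; omega
  · intro j hj; simp at hj ⊢; omega
  · intro j hj; simp at hj ⊢; omega
  · intro j hj; simp at hj ⊢; omega

lemma sum_orderStat_le {n k : ℕ} (hkn : k ≤ n) {J : Finset ℕ} (hJ : J ⊆ Finset.Icc 1 k)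
    {t : ℝ} (ht : 0 ≤ t) (v : Fin n → ℝ) :
    ∑ j ∈ J, orderStat n j v ≤ k * t + ∑ i, max (v i - t) 0 := by
  have hcard : (J.card : ℝ) ≤ k := by
    have := Finset.card_le_card hJ
    simp only [Nat.card_Icc, add_tsub_cancel_right] at this
    exact_mod_cast this
  calc ∑ j ∈ J, orderStat n j v
      ≤ ∑ j ∈ J, (t + max (orderStat n j v - t) 0) :=
        Finset.sum_le_sum fun j _ => by linarith [le_max_left (orderStat n j v - t) 0]
    _ = J.card * t + ∑ j ∈ J, max (orderStat n j v - t) 0 := by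
        rw [Finset.sum_add_distrib, Finset.sum_const, nsmul_eq_mul]
    _ ≤ k * t + ∑ j ∈ Finset.Icc 1 n, max (orderStat n j v - t) 0 := by
        refine add_le_add (mul_le_mul_of_nonneg_right hcard ht) ?_
        exact Finset.sum_le_sum_of_subset_of_nonneg
          (hJ.trans (Finset.Icc_subset_Icc_right hkn)) fun _ _ _ => le_max_right _ _
    _ = _ := by rw [sum_comp_orderStat n (fun x => max (x - t) 0) v]

/-- The value of the first coordinate exceeding a threshold is at most the largest coordinate. -/
lemma sum_first_exceeding_le {m : ℕ} (hm : 1 ≤ m) {t : ℝ} {v : Fin m → ℝ} (hv : ∀ i, 0 ≤ v i) :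
    ∑ i, ∏ j, (if j < i then (Set.Iic t).indicator 1 (v j) else
      if j = i then (Set.Ioi t).indicator id (v j) else 1) ≤ orderStat m 1 v := by
  have hnn : 0 ≤ orderStat m 1 v := (hv ⟨0, hm⟩).trans (le_orderStat_one v _)
  by_cases h : ∃ i, t < v i
  · obtain ⟨i, hi, hmin⟩ := WellFounded.has_min (α := Fin m) wellFounded_lt {i | t < v i} h
    have hbefore : ∀ j < i, v j ≤ t := fun j hj => not_lt.1 fun hlt => hmin j hlt hj
    rw [Finset.sum_eq_single i]
    · rw [Finset.prod_eq_single i]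
      · simpa [Set.indicator_of_mem (show v i ∈ Set.Ioi t from hi)] using le_orderStat_one v i
      · intro j _ hji
        by_cases hlt : j < i
        · simp [hlt, hbefore j hlt]
        · simp [hlt, hji]
      · simp
    · intro i' _ hne
      rcases lt_or_gt_of_ne hne with hlt | hgt
      · refine Finset.prod_eq_zero (Finset.mem_univ i') ?_
        simp [hbefore i' hlt]
      · refine Finset.prod_eq_zero (Finset.mem_univ i) ?_
        have : ¬ v i ≤ t := not_le.2 hi
        simp [hgt, this]
    · simp
  · push Not at h
    rw [Finset.sum_eq_zero]
    · exact hnn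
    · intro i _
      refine Finset.prod_eq_zero (Finset.mem_univ i) ?_
      simp [h i]

end OrderStatistics

section Comparison

lemma sum_pow_sq_mul_le (m : ℕ) {x y : ℝ} (hx : 0 ≤ x) (hxy : x ≤ y) (hy : y ≤ 1) :
    x ^ m * ∑ i ∈ Finset.range (m + 1), (y ^ 2) ^ i ≤
      y ^ m * ∑ i ∈ Finset.range (m + 1), (x ^ 2) ^ i := by
  have hy0 : 0 ≤ y := hx.trans hxy
  have hx1 : x ≤ 1 := hxy.trans hy
  have key : ∀ i j : ℕ, i ≤ j → x ^ (i + j) * ((y ^ 2) ^ i + (y ^ 2) ^ j) ≤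
      y ^ (i + j) * ((x ^ 2) ^ i + (x ^ 2) ^ j) := by
    intro i j hij
    obtain ⟨d, rfl⟩ := Nat.exists_eq_add_of_le hij
    have h1 : x ^ d ≤ y ^ d := pow_le_pow_left₀ hx hxy d
    have h2 : x ^ d * y ^ d ≤ 1 := mul_le_one₀ (pow_le_one₀ hx hx1) (by positivity)
      (pow_le_one₀ hy0 hy)
    have h3 : 0 ≤ (x ^ i) ^ 2 * (y ^ i) ^ 2 * ((y ^ d - x ^ d) * (1 - x ^ d * y ^ d)) :=
      mul_nonneg (by positivity) (mul_nonneg (by linarith) (by linarith))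
    have h4 : y ^ (i + (i + d)) * ((x ^ 2) ^ i + (x ^ 2) ^ (i + d)) -
        x ^ (i + (i + d)) * ((y ^ 2) ^ i + (y ^ 2) ^ (i + d)) =
        (x ^ i) ^ 2 * (y ^ i) ^ 2 * ((y ^ d - x ^ d) * (1 - x ^ d * y ^ d)) := by ring
    linarith
  have hrefl : ∀ z : ℝ, 2 * ∑ i ∈ Finset.range (m + 1), z ^ i =
      ∑ i ∈ Finset.range (m + 1), (z ^ i + z ^ (m - i)) := by
    intro z
    rw [Finset.sum_add_distrib, two_mul, ← Finset.sum_range_reflect (fun i => z ^ i) (m + 1)]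
    simp
  have : x ^ m * (2 * ∑ i ∈ Finset.range (m + 1), (y ^ 2) ^ i) ≤
      y ^ m * (2 * ∑ i ∈ Finset.range (m + 1), (x ^ 2) ^ i) := by
    rw [hrefl, hrefl, Finset.mul_sum, Finset.mul_sum]
    refine Finset.sum_le_sum fun i hi => ?_
    have him : i ≤ m := by simp at hi; omega
    rcases le_total i (m - i) with h | h
    · have := key i (m - i) h
      rwa [Nat.add_sub_cancel' him] at this
    · have := key (m - i) i h
      rw [Nat.sub_add_cancel him] at this
      linarith
  linarith

lemma monotoneOn_pow_mul_sum_rpow (m : ℕ) {l : ℝ} (hl : l ≤ 1) :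
    MonotoneOn (fun z : ℝ => z ^ m * (∑ i ∈ Finset.range (m + 1), z ^ i) ^ (-1 - l))
      (Set.Icc 0 1) := by
  have hS : ∀ z : ℝ, 0 ≤ z → 0 < ∑ i ∈ Finset.range (m + 1), z ^ i := fun z hz => by
    rw [Finset.sum_range_succ']
    positivity
  intro z hz w hw hzw
  have hSz := hS z hz.1
  have hSw := hS w hw.1
  have hmono : ∑ i ∈ Finset.range (m + 1), z ^ i ≤ ∑ i ∈ Finset.range (m + 1), w ^ i :=
    Finset.sum_le_sum fun i _ => pow_le_pow_left₀ hz.1 hzw i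
  have h := sum_pow_sq_mul_le m (Real.sqrt_nonneg z) (Real.sqrt_le_sqrt hzw)
    (Real.sqrt_le_one.2 hw.2)
  rw [Real.sq_sqrt hz.1, Real.sq_sqrt hw.1] at h
  have h2 := pow_le_pow_left₀ (by positivity) h 2
  rw [mul_pow, mul_pow, ← pow_mul, ← pow_mul, mul_comm m, pow_mul, pow_mul, Real.sq_sqrt hz.1,
    Real.sq_sqrt hw.1] at h2
  simp only
  generalize ∑ i ∈ Finset.range (m + 1), z ^ i = S at *
  generalize ∑ i ∈ Finset.range (m + 1), w ^ i = T at *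
  have split : ∀ r : ℝ, 0 < r → r ^ (-1 - l) = r ^ (1 - l) / r ^ 2 := fun r hr => by
    rw [← Real.rpow_natCast r 2, ← Real.rpow_sub hr]
    congr 1
    push_cast
    ring
  rw [split S hSz, split T hSw, mul_div_left_comm (z ^ m), mul_div_left_comm (w ^ m)]
  refine mul_le_mul (Real.rpow_le_rpow hSz.le hmono (by linarith)) ?_
    (div_nonneg (pow_nonneg hz.1 _) (sq_nonneg S)) (Real.rpow_nonneg hSw.le _)
  rw [div_le_div_iff₀ (by positivity) (by positivity)]
  exact h2

/-- As functions of `z`, `(1 - z ^ (m + 1)) ^ (-l)` is a convex function of `(1 - z) ^ (-l)`: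
it lies above each of its tangents. -/
lemma exists_tangent_one_sub_pow_rpow (m : ℕ) {l : ℝ} (hl0 : 0 ≤ l) (hl1 : l ≤ 1) {z₀ : ℝ}
    (hz₀ : z₀ ∈ Set.Ico (0 : ℝ) 1) :
    ∃ κ : ℝ, 0 ≤ κ ∧ ∀ z ∈ Set.Ico (0 : ℝ) 1,
      (1 - z₀ ^ (m + 1)) ^ (-l) + κ * ((1 - z) ^ (-l) - (1 - z₀) ^ (-l)) ≤
        (1 - z ^ (m + 1)) ^ (-l) := by
  set g : ℝ → ℝ := fun z => z ^ m * (∑ i ∈ Finset.range (m + 1), z ^ i) ^ (-1 - l) with hg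
  have hmono := monotoneOn_pow_mul_sum_rpow m hl1
  set κ : ℝ := (m + 1) * g z₀ with hκ
  have hg0 : 0 ≤ g z₀ := mul_nonneg (pow_nonneg hz₀.1 _)
    (Real.rpow_nonneg (Finset.sum_nonneg fun i _ => pow_nonneg hz₀.1 i) _)
  refine ⟨κ, by positivity, ?_⟩
  set D : ℝ → ℝ := fun z => (1 - z ^ (m + 1)) ^ (-l) - κ * (1 - z) ^ (-l) with hD
  have hder : ∀ z ∈ Set.Ico (0 : ℝ) 1, HasDerivAt D
      (l * (1 - z) ^ (-1 - l) * ((m + 1) * (g z - g z₀))) z := by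
    intro z hz
    have hpos : 0 < 1 - z := by linarith [hz.2]
    have hS : 0 < ∑ i ∈ Finset.range (m + 1), z ^ i := by
      rw [Finset.sum_range_succ']
      have := hz.1
      positivity
    have hfac : 1 - z ^ (m + 1) = (1 - z) * ∑ i ∈ Finset.range (m + 1), z ^ i := by
      linarith [geom_sum_mul z (m + 1)]
    have hpos' : 0 < 1 - z ^ (m + 1) := by rw [hfac]; positivity
    have h1 := (((hasDerivAt_pow (m + 1) z).const_sub 1).rpow_const (p := -l) (Or.inl hpos'.ne'))
    have h2 := ((((hasDerivAt_id z).const_sub 1).rpow_const (p := -l)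
      (Or.inl hpos.ne')).const_mul κ)
    refine (h1.sub h2).congr_deriv ?_
    have e : (-l - 1 : ℝ) = -1 - l := by ring
    simp only [id, e, hfac, Real.mul_rpow hpos.le hS.le, hκ, hg]
    push_cast
    ring
  intro z hz
  suffices D z₀ ≤ D z by simp only [hD] at this; linarith
  have hsub : ∀ {u w : ℝ}, u ∈ Set.Ico (0 : ℝ) 1 → w ∈ Set.Ico (0 : ℝ) 1 →
      Set.Icc u w ⊆ Set.Ico (0 : ℝ) 1 := fun hu hw y hy =>
    ⟨hu.1.trans hy.1, hy.2.trans_lt hw.2⟩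
  have hfactor : ∀ y ∈ Set.Ico (0 : ℝ) 1, 0 ≤ l * (1 - y) ^ (-1 - l) := fun y hy =>
    mul_nonneg hl0 (Real.rpow_nonneg (by linarith [hy.2]) _)
  have hIcc : Set.Ico (0 : ℝ) 1 ⊆ Set.Icc 0 1 := Set.Ico_subset_Icc_self
  rcases le_total z₀ z with h | h
  · refine monotoneOn_of_hasDerivWithinAt_nonneg (convex_Icc z₀ z)
      (fun y hy => (hder y (hsub hz₀ hz hy)).continuousAt.continuousWithinAt)
      (fun y hy => (hder y (hsub hz₀ hz (interior_subset hy))).hasDerivWithinAt) ?_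
      (Set.left_mem_Icc.2 h) (Set.right_mem_Icc.2 h) h
    intro y hy
    have hy' := interior_subset hy
    have := hmono (hIcc hz₀) (hIcc (hsub hz₀ hz hy')) hy'.1
    exact mul_nonneg (hfactor y (hsub hz₀ hz hy'))
      (mul_nonneg (by positivity) (sub_nonneg.2 this))
  · refine antitoneOn_of_hasDerivWithinAt_nonpos (convex_Icc z z₀)
      (fun y hy => (hder y (hsub hz hz₀ hy)).continuousAt.continuousWithinAt)
      (fun y hy => (hder y (hsub hz hz₀ (interior_subset hy))).hasDerivWithinAt) ?_
      (Set.left_mem_Icc.2 h) (Set.right_mem_Icc.2 h) h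
    intro y hy
    have hy' := interior_subset hy
    have := hmono (hIcc (hsub hz hz₀ hy')) (hIcc hz₀) hy'.2
    exact mul_nonpos_of_nonneg_of_nonpos (hfactor y (hsub hz hz₀ hy'))
      (mul_nonpos_of_nonneg_of_nonpos (by positivity) (sub_nonpos.2 this))

end Comparison

section CDF

variable {F f : ℝ → ℝ} {a : ℝ} {b : EReal} {μ : Measure ℝ}

lemma IsCDF.exists_lt_apply (hF : IsCDF F f a b) {y : ℝ} (hy : y < 1) :
    ∃ x : ℝ, a ≤ x ∧ (x : EReal) < b ∧ y < F x := by
  obtain ⟨hab, hmono, -, -, hlim⟩ := hF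
  have hev := hlim.eventually (lt_mem_nhds hy)
  rw [eventually_comap] at hev
  obtain ⟨c, hc, hcb⟩ := (mem_nhdsLT_iff_exists_Ioo_subset' hab).1 hev
  obtain ⟨x, hx1, hx2⟩ := EReal.lt_iff_exists_real_btwn.1 (max_lt hab hc)
  exact ⟨x, EReal.coe_le_coe_iff.1 ((le_max_left _ _).trans hx1.le), hx2,
    hcb ⟨(le_max_right _ _).trans_lt hx1, hx2⟩ x rfl⟩

lemma IsCDF.apply_lt_apply (hF : IsCDF F f a b) {x y : ℝ} (hx : a ≤ x) (hxy : x < y)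
    (hy : (y : EReal) < b) : F x < F y := by
  have hd : ∀ z ∈ Set.Icc x y, HasDerivAt F (f z) z ∧ 0 < f z := fun z hz =>
    hF.2.2.2.1 z (hx.trans hz.1) ((EReal.coe_le_coe_iff.2 hz.2).trans_lt hy)
  refine strictMonoOn_of_deriv_pos (convex_Icc x y)
    (fun z hz => (hd z hz).1.continuousAt.continuousWithinAt) (fun z hz => ?_)
    (Set.left_mem_Icc.2 hxy.le) (Set.right_mem_Icc.2 hxy.le) hxy
  rw [(hd z (interior_subset hz)).1.deriv]
  exact (hd z (interior_subset hz)).2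

lemma IsCDF.apply_nonneg (hF : IsCDF F f a b) {x : ℝ} (hx : a ≤ x) : 0 ≤ F x :=
  hF.2.2.1 ▸ hF.2.1 hx

lemma IsCDF.apply_lt_one (hF : IsCDF F f a b) (hμ : InducedBy μ F a b) {x : ℝ} (hx : a ≤ x)
    (hxb : (x : EReal) < b) : F x < 1 := by
  obtain ⟨y, hxy, hyb⟩ := EReal.lt_iff_exists_real_btwn.1 hxb
  have hxy' : x < y := EReal.coe_lt_coe_iff.1 hxy
  refine (hF.apply_lt_apply hx hxy' hyb).trans_le ?_
  have := hμ.1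
  have h := hμ.2 y (hx.trans hxy'.le) hyb
  have h1 : μ (Set.Iic y) ≤ 1 := prob_le_one
  rw [h, ENNReal.ofReal_le_one] at h1
  exact h1

lemma IsCDF.exists_apply_eq (hF : IsCDF F f a b) {y : ℝ} (hy : y ∈ Set.Ico (0 : ℝ) 1) :
    ∃ x : ℝ, a ≤ x ∧ (x : EReal) < b ∧ F x = y := by
  obtain ⟨w, haw, hwb, hw⟩ := hF.exists_lt_apply hy.2
  have hcont : ContinuousOn F (Set.Icc a w) := fun z hz =>
    (hF.2.2.2.1 z hz.1
      ((EReal.coe_le_coe_iff.2 hz.2).trans_lt hwb)).1.continuousAt.continuousWithinAt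
  obtain ⟨x, hx, hxy⟩ := intermediate_value_Icc haw hcont
    ⟨by rw [hF.2.2.1]; exact hy.1, hw.le⟩
  exact ⟨x, hx.1, (EReal.coe_le_coe_iff.2 hx.2).trans_lt hwb, hxy⟩

lemma IsCDF.ae_mem (hF : IsCDF F f a b) (hμ : InducedBy μ F a b) :
    ∀ᵐ x ∂μ, a < x ∧ (x : EReal) < b := by
  have := hμ.1
  have h1 : ∀ᵐ x ∂μ, a < x := by
    rw [ae_iff]
    have : {x | ¬ a < x} = Set.Iic a := by ext; simp
    rw [this, hμ.2 a le_rfl hF.1, hF.2.2.1, ENNReal.ofReal_zero]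
  have h2 : ∀ᵐ x : ℝ ∂μ, (x : EReal) < b := by
    rw [ae_iff]
    refine le_antisymm (ENNReal.le_of_forall_pos_le_add fun ε hε _ => ?_) zero_le
    obtain ⟨x, hx, hxb, hFx⟩ := hF.exists_lt_apply (sub_lt_self 1 (NNReal.coe_pos.2 hε))
    have hsub : {z : ℝ | ¬ (z : EReal) < b} ⊆ (Set.Iic x)ᶜ := by
      intro z hz hzx
      exact hz ((EReal.coe_le_coe_iff.2 hzx).trans_lt hxb)
    refine (measure_mono hsub).trans ?_
    rw [prob_compl_eq_one_sub measurableSet_Iic, hμ.2 x hx hxb, zero_add, tsub_le_iff_right,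
      ← ENNReal.ofReal_coe_nnreal, ← ENNReal.ofReal_add ε.coe_nonneg (hF.apply_nonneg hx),
      ← ENNReal.ofReal_one]
    exact ENNReal.ofReal_le_ofReal (by linarith)
  filter_upwards [h1, h2] with x hx1 hx2 using ⟨hx1, hx2⟩

lemma IsCDF.ae_pi_mem (hF : IsCDF F f a b) (hμ : InducedBy μ F a b) (t : ℕ) :
    ∀ᵐ v ∂(Measure.pi fun _ : Fin t => μ), ∀ i, a < v i ∧ (v i : EReal) < b := by
  have := hμ.1
  rw [ae_all_iff]
  intro i
  exact (measurePreserving_eval (fun _ : Fin t => μ) i).quasiMeasurePreserving.ae (hF.ae_mem hμ)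

lemma IsCDF.ae_orderStat_one_mem (hF : IsCDF F f a b) (hμ : InducedBy μ F a b) {t : ℕ}
    (ht : 1 ≤ t) :
    ∀ᵐ v ∂(Measure.pi fun _ : Fin t => μ),
      a < orderStat t 1 v ∧ (orderStat t 1 v : EReal) < b := by
  filter_upwards [hF.ae_pi_mem hμ t] with v hv
  obtain ⟨i, hi⟩ := exists_orderStat_one_eq ht v
  rw [hi]
  exact hv i

/-- Probability integral transform for the maximum of `t` draws. -/
lemma IsCDF.map_orderStat_one (hF : IsCDF F f a b) (hμ : InducedBy μ F a b) {t : ℕ}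
    (ht : 1 ≤ t) :
    (Measure.pi fun _ : Fin t => μ).map (fun v => F (orderStat t 1 v) ^ t) =
      volume.restrict (Set.Ioc 0 1) := by
  have := hμ.1
  have hmeas : Measurable fun v : Fin t → ℝ => F (orderStat t 1 v) ^ t :=
    (hF.2.1.measurable.comp (measurable_orderStat_one ht)).pow_const t
  have hae := hF.ae_orderStat_one_mem hμ ht
  have := Measure.isProbabilityMeasure_map (μ := Measure.pi fun _ : Fin t => μ) hmeas.aemeasurable
  refine Measure.ext_of_Iic _ _ fun y => ?_
  rw [Measure.map_apply hmeas measurableSet_Iic, Measure.restrict_apply measurableSet_Iic]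
  rcases lt_or_ge y 0 with hy | hy
  · have h1 : Set.Iic y ∩ Set.Ioc 0 1 = ∅ := by
      refine Set.eq_empty_of_forall_notMem ?_
      rintro z ⟨h, h', -⟩
      exact absurd h (not_le.2 (hy.trans h'))
    rw [h1, measure_empty]
    refine measure_mono_null (t := {v | ¬ (a < orderStat t 1 v ∧ (orderStat t 1 v : EReal) < b)})
      (fun v hv h => ?_) hae
    have : 0 ≤ F (orderStat t 1 v) ^ t := pow_nonneg (hF.apply_nonneg h.1.le) t
    simp only [Set.mem_preimage, Set.mem_Iic] at hv
    linarith
  rcases lt_or_ge y 1 with hy1 | hy1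
  · obtain ⟨x, hx, hxb, hFx⟩ := hF.exists_apply_eq (y := y ^ ((1 : ℝ) / t))
      ⟨by positivity, Real.rpow_lt_one hy hy1 (by positivity)⟩
    have hpow : F x ^ t = y := by
      rw [hFx, one_div, Real.rpow_inv_natCast_pow hy (by omega)]
    have h1 : Set.Iic y ∩ Set.Ioc 0 1 = Set.Ioc 0 y := by
      ext z; simp only [Set.mem_inter_iff, Set.mem_Iic, Set.mem_Ioc]
      constructor
      · rintro ⟨h, h', -⟩; exact ⟨h', h⟩
      · rintro ⟨h, h'⟩; exact ⟨h', h, by linarith⟩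
    have h2 : ((fun v : Fin t → ℝ => F (orderStat t 1 v) ^ t) ⁻¹' Set.Iic y : Set (Fin t → ℝ))
        =ᵐ[Measure.pi fun _ : Fin t => μ] (orderStat t 1 ⁻¹' Set.Iic x : Set (Fin t → ℝ)) := by
      filter_upwards [hae] with v hv
      refine propext ?_
      change F (orderStat t 1 v) ^ t ≤ y ↔ orderStat t 1 v ≤ x
      rw [← hpow]
      refine ⟨fun h => ?_, fun h => pow_le_pow_left₀ (hF.apply_nonneg hv.1.le) (hF.2.1 h) t⟩
      by_contra hlt
      exact absurd h (not_le.2 (pow_lt_pow_left₀ (hF.apply_lt_apply hx (not_le.1 hlt) hv.2)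
        (hF.apply_nonneg hx) (by omega)))
    rw [h1, measure_congr h2, orderStat_one_preimage_Iic ht, Measure.pi_pi, Real.volume_Ioc,
      sub_zero]
    simp only [hμ.2 x hx hxb, Finset.prod_const, Finset.card_univ, Fintype.card_fin]
    rw [← ENNReal.ofReal_pow (hF.apply_nonneg hx), hpow]
  · have h1 : Set.Iic y ∩ Set.Ioc 0 1 = Set.Ioc 0 1 :=
      Set.inter_eq_right.2 fun z hz => hz.2.trans hy1
    rw [h1, Real.volume_Ioc, sub_zero, ENNReal.ofReal_one, ← measure_univ (μ := Measure.pi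
      fun _ : Fin t => μ)]
    refine measure_congr (eventuallyEq_univ.2 ?_)
    filter_upwards [hae] with v hv
    exact (pow_le_one₀ (hF.apply_nonneg hv.1.le) (hF.apply_lt_one hμ hv.1.le hv.2).le).trans hy1

lemma IsCDF.integrable_one_sub_pow_rpow (hF : IsCDF F f a b) (hμ : InducedBy μ F a b) {t : ℕ}
    (ht : 1 ≤ t) {l : ℝ} (hl : l < 1) :
    Integrable (fun v => (1 - F (orderStat t 1 v) ^ t) ^ (-l)) (Measure.pi fun _ : Fin t => μ) ∧
    ∫ v, (1 - F (orderStat t 1 v) ^ t) ^ (-l) ∂(Measure.pi fun _ : Fin t => μ) = 1 / (1 - l) := by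
  have hmeas : Measurable fun v : Fin t → ℝ => F (orderStat t 1 v) ^ t :=
    (hF.2.1.measurable.comp (measurable_orderStat_one ht)).pow_const t
  have hφ : Measurable fun y : ℝ => (1 - y) ^ (-l) := by fun_prop
  constructor
  · have h : IntervalIntegrable (fun y : ℝ => (1 - y) ^ (-l)) volume 0 1 := by
      simpa using ((intervalIntegral.intervalIntegrable_rpow' (a := 0) (b := 1)
        (show -1 < -l by linarith)).comp_sub_left 1).symm
    rw [intervalIntegrable_iff_integrableOn_Ioc_of_le zero_le_one, IntegrableOn,
      ← hF.map_orderStat_one hμ ht] at h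
    exact (integrable_map_measure hφ.aestronglyMeasurable hmeas.aemeasurable).1 h
  · have h := integral_map (μ := Measure.pi fun _ : Fin t => μ) hmeas.aemeasurable
      hφ.aestronglyMeasurable
    rw [← h, hF.map_orderStat_one hμ ht, ← intervalIntegral.integral_of_le zero_le_one,
      intervalIntegral.integral_comp_sub_left (fun y : ℝ => y ^ (-l)),
      integral_rpow (Or.inl (by linarith))]
    have : -l + 1 ≠ 0 := by linarith
    simp [Real.zero_rpow this]
    ring

lemma LambdaRegular.mono {l l' : ℝ} (h : LambdaRegular l F f a b) (hl : l ≤ l') :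
    LambdaRegular l' F f a b := by
  intro x hx y hy hxy
  have h1 := h hx hy hxy
  have h2 := mul_le_mul_of_nonneg_left hxy (sub_nonneg.2 hl)
  simp only at h1 ⊢
  linarith

/-- For a `l`-regular distribution, `(1 - F) ^ (-l)` is convex. -/
lemma LambdaRegular.exists_tangent {l : ℝ} (hreg : LambdaRegular l F f a b) (hl : 0 < l)
    (hF : IsCDF F f a b) (hμ : InducedBy μ F a b) {p : ℝ} (hp : a ≤ p) (hpb : (p : EReal) < b) :
    ∃ c : ℝ, ∀ x : ℝ, a ≤ x → (x : EReal) < b →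
      (1 - F p) ^ (-l) + c * (x - p) ≤ (1 - F x) ^ (-l) := by
  set h : ℝ → ℝ := fun x => (1 - F x) / f x with hh
  set E : ℝ → ℝ := fun x => (h p + l * (x - p)) * (1 - F x) ^ l with hE
  have hder : ∀ x : ℝ, a ≤ x → (x : EReal) < b → HasDerivAt E
      (l * (1 - F x) ^ (l - 1) * f x * (h x - (h p + l * (x - p)))) x := by
    intro x hx hxb
    have hpos : 0 < 1 - F x := sub_pos.2 (hF.apply_lt_one hμ hx hxb)
    obtain ⟨hd, hf⟩ := hF.2.2.2.1 x hx hxb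
    have h1 : HasDerivAt (fun x => h p + l * (x - p)) (l * 1) x :=
      (((hasDerivAt_id x).sub_const p).const_mul l).const_add (h p)
    have h2 := (hd.const_sub 1).rpow_const (p := l) (Or.inl hpos.ne')
    refine (h1.mul h2).congr_deriv ?_
    have h3 : (1 - F x) ^ l = (1 - F x) ^ (l - 1) * (1 - F x) := by
      rw [← Real.rpow_add_one hpos.ne', sub_add_cancel]
    have h4 : f x * h x = 1 - F x := mul_div_cancel₀ _ hf.ne'
    rw [h3]
    linear_combination (-(l * (1 - F x) ^ (l - 1))) * h4
  have hfac : ∀ x : ℝ, a ≤ x → (x : EReal) < b → 0 ≤ l * (1 - F x) ^ (l - 1) * f x :=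
    fun x hx hxb => mul_nonneg (mul_nonneg hl.le (Real.rpow_nonneg
      (sub_nonneg.2 (hF.apply_lt_one hμ hx hxb).le) _)) (hF.2.2.2.1 x hx hxb).2.le
  have hhp : 0 < h p := div_pos (sub_pos.2 (hF.apply_lt_one hμ hp hpb)) (hF.2.2.2.1 p hp hpb).2
  have hmax : ∀ x : ℝ, a ≤ x → (x : EReal) < b → E x ≤ E p := by
    intro x hx hxb
    rcases le_total p x with hpx | hxp
    · have hmem : ∀ y ∈ Set.Icc p x, a ≤ y ∧ (y : EReal) < b := fun y hy =>
        ⟨hp.trans hy.1, (EReal.coe_le_coe_iff.2 hy.2).trans_lt hxb⟩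
      refine antitoneOn_of_hasDerivWithinAt_nonpos (convex_Icc p x)
        (fun y hy => (hder y (hmem y hy).1 (hmem y hy).2).continuousAt.continuousWithinAt)
        (fun y hy => (hder y (hmem y (interior_subset hy)).1
          (hmem y (interior_subset hy)).2).hasDerivWithinAt) ?_
        (Set.left_mem_Icc.2 hpx) (Set.right_mem_Icc.2 hpx) hpx
      intro y hy
      have hy' := interior_subset hy
      have hr := hreg ⟨hp, hpb⟩ (hmem y hy') hy'.1
      refine mul_nonpos_of_nonneg_of_nonpos (hfac y (hmem y hy').1 (hmem y hy').2) ?_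
      simp only [hh] at hr ⊢
      linarith
    · have hmem : ∀ y ∈ Set.Icc x p, a ≤ y ∧ (y : EReal) < b := fun y hy =>
        ⟨hx.trans hy.1, (EReal.coe_le_coe_iff.2 hy.2).trans_lt hpb⟩
      refine monotoneOn_of_hasDerivWithinAt_nonneg (convex_Icc x p)
        (fun y hy => (hder y (hmem y hy).1 (hmem y hy).2).continuousAt.continuousWithinAt)
        (fun y hy => (hder y (hmem y (interior_subset hy)).1
          (hmem y (interior_subset hy)).2).hasDerivWithinAt) ?_
        (Set.left_mem_Icc.2 hxp) (Set.right_mem_Icc.2 hxp) hxp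
      intro y hy
      have hy' := interior_subset hy
      have hr := hreg (hmem y hy') ⟨hp, hpb⟩ hy'.2
      refine mul_nonneg (hfac y (hmem y hy').1 (hmem y hy').2) ?_
      simp only [hh] at hr ⊢
      linarith
  refine ⟨l * (1 - F p) ^ (-l) / h p, fun x hx hxb => ?_⟩
  have hm := hmax x hx hxb
  have hP : 0 < 1 - F p := sub_pos.2 (hF.apply_lt_one hμ hp hpb)
  have hX : 0 < 1 - F x := sub_pos.2 (hF.apply_lt_one hμ hx hxb)
  have hPl := Real.rpow_pos_of_pos hP l
  have hXl := Real.rpow_pos_of_pos hX l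
  simp only [hE, sub_self, mul_zero, add_zero] at hm
  rw [Real.rpow_neg hP.le, Real.rpow_neg hX.le]
  have e : ((1 - F p) ^ l)⁻¹ + l * ((1 - F p) ^ l)⁻¹ / h p * (x - p) =
      (h p + l * (x - p)) / (h p * (1 - F p) ^ l) := by
    field_simp
  rw [e, div_le_iff₀ (by positivity), ← div_eq_inv_mul, le_div_iff₀ hXl]
  exact hm

end CDF

section Mean

variable {F f : ℝ → ℝ} {a : ℝ} {b : EReal} {μ : Measure ℝ}

lemma lt_integral_of_ae_lt {Ω : Type*} [MeasurableSpace Ω] {P : Measure Ω} [IsProbabilityMeasure P]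
    {X : Ω → ℝ} {c : ℝ} (hX : Integrable X P) (h : ∀ᵐ ω ∂P, c < X ω) : c < ∫ ω, X ω ∂P := by
  have hint : Integrable (fun ω => X ω - c) P := hX.sub (integrable_const c)
  have h0 : 0 ≤ᵐ[P] fun ω => X ω - c := by
    filter_upwards [h] with ω hω using (sub_pos.2 hω).le
  have hpos : 0 < ∫ ω, (X ω - c) ∂P := by
    refine lt_of_le_of_ne (integral_nonneg_of_ae h0) fun heq => ?_
    have hz := (integral_eq_zero_iff_of_nonneg_ae h0 hint).1 heq.symm
    have hfalse : ∀ᵐ _ω ∂P, False := by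
      filter_upwards [h, hz] with ω h1 h2
      simp only [Pi.zero_apply] at h2
      linarith
    exact (NeZero.ne P) (ae_eq_bot.1 (Filter.eventually_false_iff_eq_bot.1 hfalse))
  rw [integral_sub hX (integrable_const c), integral_const] at hpos
  simpa using hpos

lemma IsCDF.orderStatExp_mem (hF : IsCDF F f a b) (hμ : InducedBy μ F a b) {t : ℕ} (ht : 1 ≤ t)
    (hint : Integrable (orderStat t 1) (Measure.pi fun _ : Fin t => μ)) :
    a < orderStatExp μ 1 t ∧ (orderStatExp μ 1 t : EReal) < b := by
  have := hμ.1
  have hae := hF.ae_orderStat_one_mem hμ ht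
  refine ⟨lt_integral_of_ae_lt hint (hae.mono fun v hv => hv.1), ?_⟩
  induction b with
  | bot => exact absurd hF.1 (not_lt_bot)
  | top => exact EReal.coe_lt_top _
  | coe b =>
    have h : -b < ∫ v, -orderStat t 1 v ∂(Measure.pi fun _ : Fin t => μ) :=
      lt_integral_of_ae_lt hint.neg (hae.mono fun v hv => by
        have := EReal.coe_lt_coe_iff.1 hv.2
        linarith)
    rw [integral_neg] at h
    exact EReal.coe_lt_coe_iff.2 (neg_lt_neg_iff.1 h)

/-- The maximum of `t` draws from a `l`-regular distribution exceeds its mean with probability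
at least `(1 - l) ^ (1 / l)`. -/
lemma LambdaRegular.rpow_le_one_sub_pow_mean {l : ℝ} (hreg : LambdaRegular l F f a b)
    (hl : 0 < l) (hl1 : l < 1) (hF : IsCDF F f a b) (hμ : InducedBy μ F a b) {t : ℕ}
    (ht : 1 ≤ t) (hint : Integrable (orderStat t 1) (Measure.pi fun _ : Fin t => μ)) :
    (1 - l) ^ (1 / l) ≤ 1 - F (orderStatExp μ 1 t) ^ t := by
  have := hμ.1
  obtain ⟨hap, hpb⟩ := hF.orderStatExp_mem hμ ht hint
  set p := orderStatExp μ 1 t with hp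
  have hmem : ∀ x : ℝ, a ≤ x → (x : EReal) < b → F x ∈ Set.Ico (0 : ℝ) 1 := fun x hx hxb =>
    ⟨hF.apply_nonneg hx, hF.apply_lt_one hμ hx hxb⟩
  obtain ⟨m, rfl⟩ := Nat.exists_eq_add_of_le' ht
  obtain ⟨κ, hκ, hκt⟩ := exists_tangent_one_sub_pow_rpow m hl.le hl1.le (hmem p hap.le hpb)
  obtain ⟨c, hc⟩ := hreg.exists_tangent hl hF hμ hap.le hpb
  obtain ⟨hi, hI⟩ := hF.integrable_one_sub_pow_rpow hμ ht hl1
  have hdev : Integrable (fun v => κ * c * (orderStat (m + 1) 1 v - p))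
      (Measure.pi fun _ : Fin (m + 1) => μ) := (hint.sub (integrable_const p)).const_mul _
  have hlow : Integrable (fun v => (1 - F p ^ (m + 1)) ^ (-l) + κ * c * (orderStat (m + 1) 1 v - p))
      (Measure.pi fun _ : Fin (m + 1) => μ) :=
    (integrable_const _).add hdev
  have hle : ∫ v, ((1 - F p ^ (m + 1)) ^ (-l) + κ * c * (orderStat (m + 1) 1 v - p))
      ∂(Measure.pi fun _ : Fin (m + 1) => μ) ≤ 1 / (1 - l) := by
    rw [← hI]
    refine integral_mono_ae hlow hi ?_
    filter_upwards [hF.ae_orderStat_one_mem hμ ht] with v hv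
    refine le_trans ?_ (hκt _ (hmem _ hv.1.le hv.2))
    have := mul_le_mul_of_nonneg_left (hc _ hv.1.le hv.2) hκ
    linarith
  rw [integral_add (integrable_const _) hdev, integral_const_mul,
    integral_sub hint (integrable_const p)] at hle
  have hp' : ∫ v, orderStat (m + 1) 1 v ∂(Measure.pi fun _ : Fin (m + 1) => μ) = p := rfl
  simp only [integral_const, probReal_univ, one_smul, hp', sub_self, mul_zero, add_zero] at hle
  have hq : 0 < 1 - F p ^ (m + 1) := sub_pos.2
    (pow_lt_one₀ (hmem p hap.le hpb).1 (hmem p hap.le hpb).2 (by omega))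
  rw [Real.rpow_neg hq.le, one_div, inv_le_inv₀ (Real.rpow_pos_of_pos hq l) (by linarith)] at hle
  have := Real.rpow_le_rpow (by linarith) hle (show 0 ≤ 1 / l by positivity)
  rwa [← Real.rpow_mul hq.le, mul_one_div_cancel hl.ne', Real.rpow_one] at this

lemma LambdaRegular.cReg_le_one_sub_pow_mean {l : ℝ} (hreg : LambdaRegular l F f a b)
    (hl : 0 ≤ l) (hl1 : l < 1) (hF : IsCDF F f a b) (hμ : InducedBy μ F a b) {t : ℕ}
    (ht : 1 ≤ t) (hint : Integrable (orderStat t 1) (Measure.pi fun _ : Fin t => μ)) :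
    cReg l ≤ 1 - F (orderStatExp μ 1 t) ^ t := by
  rcases hl.eq_or_lt with rfl | hpos
  · have hlim := Real.tendsto_one_add_div_rpow_exp (-1)
    rw [cReg, if_pos rfl, ← Real.exp_neg]
    refine le_of_tendsto hlim ?_
    filter_upwards [eventually_gt_atTop 1] with x hx
    have hx0 : 0 < x := by linarith
    have := (hreg.mono (l' := 1 / x) (by positivity)).rpow_le_one_sub_pow_mean (by positivity)
      (by rw [div_lt_one hx0]; exact hx) hF hμ ht hint
    rwa [one_div_one_div, sub_eq_add_neg, ← neg_div] at this
  · rw [cReg, if_neg hpos.ne']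
    exact hreg.rpow_le_one_sub_pow_mean hpos hl1 hF hμ ht hint

end Mean

section Welfare

variable {F f : ℝ → ℝ} {a : ℝ} {b : EReal} {μ : Measure ℝ}

lemma IsCDF.ae_nonneg (hF : IsCDF F f a b) (hμ : InducedBy μ F a b) (ha : 0 ≤ a) :
    ∀ᵐ x ∂μ, 0 ≤ x :=
  (hF.ae_mem hμ).mono fun _ hx => ha.trans hx.1.le

lemma IsCDF.integrable_id (hF : IsCDF F f a b) (hμ : InducedBy μ F a b) (ha : 0 ≤ a) {n : ℕ}
    (hn : 1 ≤ n) (hint : Integrable (orderStat n 1) (Measure.pi fun _ : Fin n => μ)) :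
    Integrable id μ := by
  have := hμ.1
  have hmp := measurePreserving_eval (fun _ : Fin n => μ) ⟨0, hn⟩
  rw [← hmp.integrable_comp measurable_id.aestronglyMeasurable]
  refine hint.mono' (measurable_pi_apply _).aestronglyMeasurable ?_
  filter_upwards [hF.ae_pi_mem hμ n] with v hv
  simp only [Function.comp, Function.eval, id, Real.norm_eq_abs]
  rw [abs_of_nonneg (ha.trans (hv _).1.le)]
  exact le_orderStat_one v _

lemma integrable_orderStat_one [IsProbabilityMeasure μ] (h : Integrable id μ) {t : ℕ}
    (ht : 1 ≤ t) : Integrable (orderStat t 1) (Measure.pi fun _ : Fin t => μ) := by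
  have hi : ∀ i : Fin t, Integrable (fun v : Fin t → ℝ => |v i|)
      (Measure.pi fun _ : Fin t => μ) := fun i => integrable_comp_eval (i := i) h.abs
  refine (integrable_finsetSum Finset.univ fun i _ => hi i).mono'
    (measurable_orderStat_one ht).aestronglyMeasurable (Eventually.of_forall fun v => ?_)
  obtain ⟨i, hi⟩ := exists_orderStat_one_eq ht v
  rw [hi, Real.norm_eq_abs]
  exact Finset.single_le_sum (f := fun i => |v i|) (fun _ _ => abs_nonneg _) (Finset.mem_univ i)

/-- The expected sum of the `k` largest of `n` draws is at most `t` for each of them, plus the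
expected excess over the threshold `t` of every draw. -/
lemma sum_orderStatExp_le [IsProbabilityMeasure μ] (h : Integrable id μ) {n k : ℕ} (hkn : k ≤ n)
    {t : ℝ} (ht : 0 ≤ t) :
    ∑ j ∈ Finset.Icc 1 k, orderStatExp μ j n ≤ k * t + n * ∫ x, max (x - t) 0 ∂μ := by
  classical
  set P := Measure.pi fun _ : Fin n => μ with hP
  set J := (Finset.Icc 1 k).filter fun j => Integrable (orderStat n j) P with hJ
  have hpos : Integrable (fun x => max (x - t) 0) μ := (h.sub (integrable_const t)).pos_part
  have hi : ∀ i : Fin n, Integrable (fun v : Fin n → ℝ => max (v i - t) 0) P := fun i =>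
    integrable_comp_eval (X := fun _ : Fin n => ℝ) (μ := fun _ => μ) (i := i)
      (f := fun x : ℝ => max (x - t) 0) hpos
  have h1 : ∑ j ∈ Finset.Icc 1 k, orderStatExp μ j n = ∑ j ∈ J, orderStatExp μ j n := by
    refine (Finset.sum_subset (Finset.filter_subset _ _) fun j hj hjJ => ?_).symm
    refine integral_undef fun hint => hjJ ?_
    exact Finset.mem_filter.2 ⟨hj, hint⟩
  have h2 : ∑ j ∈ J, orderStatExp μ j n = ∫ v, ∑ j ∈ J, orderStat n j v ∂P :=
    (integral_finsetSum J fun j hj => (Finset.mem_filter.1 hj).2).symm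
  rw [h1, h2]
  calc ∫ v, ∑ j ∈ J, orderStat n j v ∂P
      ≤ ∫ v, (k * t + ∑ i, max (v i - t) 0) ∂P :=
        integral_mono (integrable_finsetSum J fun j hj => (Finset.mem_filter.1 hj).2)
          ((integrable_const _).add (integrable_finsetSum _ fun i _ => hi i))
          (fun v => sum_orderStat_le hkn (Finset.filter_subset _ _) ht v)
    _ = k * t + ∑ i : Fin n, ∫ v, max (v i - t) 0 ∂P := by
        rw [integral_add (integrable_const _) (integrable_finsetSum _ fun i _ => hi i),
          integral_finsetSum _ fun i _ => hi i]
        simp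
    _ = k * t + n * ∫ x, max (x - t) 0 ∂μ := by
        have : ∀ i : Fin n, ∫ v, max (v i - t) 0 ∂P = ∫ x, max (x - t) 0 ∂μ := fun i =>
          integral_comp_eval (X := fun _ : Fin n => ℝ) (μ := fun _ => μ) (i := i)
            (f := fun x : ℝ => max (x - t) 0) hpos.aestronglyMeasurable
        simp [this]

/-- Lower bound on the expected maximum by the expectation of the first draw exceeding `t`. -/
lemma integral_indicator_mul_geom_sum_le [IsProbabilityMeasure μ] (h : Integrable id μ)
    (hnn : ∀ᵐ x ∂μ, 0 ≤ x) {s : ℕ} (hs : 1 ≤ s) (t : ℝ) :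
    (∫ x in Set.Ioi t, x ∂μ) * ∑ i ∈ Finset.range s, μ.real (Set.Iic t) ^ i ≤
      orderStatExp μ 1 s := by
  set P := Measure.pi fun _ : Fin s => μ with hP
  set g : Fin s → Fin s → ℝ → ℝ := fun i j x =>
    if j < i then (Set.Iic t).indicator 1 x else
      if j = i then (Set.Ioi t).indicator id x else 1 with hg
  have hgint : ∀ i j, Integrable (g i j) μ := by
    intro i j
    simp only [hg]
    split_ifs
    · exact (integrable_const (1 : ℝ)).indicator measurableSet_Iic
    · exact h.indicator measurableSet_Ioi
    · exact integrable_const _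
  have hprod : ∀ i, Integrable (fun v : Fin s → ℝ => ∏ j, g i j (v j)) P := fun i =>
    Integrable.fintype_prod fun j => hgint i j
  have hval : ∀ i, ∫ v, ∏ j, g i j (v j) ∂P =
      (∫ x in Set.Ioi t, x ∂μ) * μ.real (Set.Iic t) ^ (i : ℕ) := by
    intro i
    rw [hP, integral_fintype_prod_eq_prod]
    have hj : ∀ j, ∫ x, g i j x ∂μ = (if j < i then μ.real (Set.Iic t) else 1) *
        (if j = i then ∫ x in Set.Ioi t, x ∂μ else 1) := by
      intro j
      simp only [hg]
      by_cases h1 : j < i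
      · simp [h1, h1.ne, integral_indicator_one measurableSet_Iic]
      · by_cases h2 : j = i
        · simp [h2, integral_indicator measurableSet_Ioi]
        · simp [h1, h2]
    simp only [hj, Finset.prod_mul_distrib, Finset.prod_ite_eq', Finset.mem_univ, if_true]
    rw [mul_comm, Finset.prod_ite, Finset.prod_const, Finset.prod_const_one, mul_one]
    congr 2
    rw [Finset.filter_gt_eq_Iio, Fin.card_Iio]
  have hsum : (∫ x in Set.Ioi t, x ∂μ) * ∑ i ∈ Finset.range s, μ.real (Set.Iic t) ^ i =
      ∫ v, ∑ i, ∏ j, g i j (v j) ∂P := by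
    rw [integral_finsetSum _ fun i _ => hprod i, Finset.mul_sum, Finset.sum_range]
    exact Finset.sum_congr rfl fun i _ => (hval i).symm
  rw [hsum]
  refine integral_mono_ae (integrable_finsetSum _ fun i _ => hprod i)
    (integrable_orderStat_one h hs) ?_
  have hall : ∀ᵐ v ∂P, ∀ i, 0 ≤ v i := by
    rw [ae_all_iff]
    exact fun i => (measurePreserving_eval (fun _ : Fin s => μ) i).quasiMeasurePreserving.ae hnn
  filter_upwards [hall] with v hv using sum_first_exceeding_le hs hv

lemma IsCDF.sum_orderStatExp_le_mul (hF : IsCDF F f a b) (hμ : InducedBy μ F a b) (ha : 0 ≤ a)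
    (h : Integrable id μ) {k s : ℕ} (hs : 1 ≤ s) :
    (1 - 1 / Real.exp 1) * ∑ j ∈ Finset.Icc 1 k, orderStatExp μ j (k * s) ≤
      k * orderStatExp μ 1 s := by
  have := hμ.1
  have hs0 : (0 : ℝ) < s := by exact_mod_cast hs
  have hs1 : (1 : ℝ) ≤ s := by exact_mod_cast hs
  have hz : (1 - 1 / (s : ℝ)) ∈ Set.Ico (0 : ℝ) 1 :=
    ⟨sub_nonneg.2 ((div_le_one hs0).2 hs1), sub_lt_self _ (by positivity)⟩
  obtain ⟨t, hat, htb, hFt⟩ := hF.exists_apply_eq hz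
  have ht : 0 ≤ t := ha.trans hat
  have hIic : μ.real (Set.Iic t) = 1 - 1 / (s : ℝ) := by
    rw [measureReal_def, hμ.2 t hat htb, ENNReal.toReal_ofReal (hF.apply_nonneg hat), hFt]
  have hIoi : μ.real (Set.Ioi t) = 1 / (s : ℝ) := by
    rw [← Set.compl_Iic, probReal_compl_eq_one_sub measurableSet_Iic, hIic, sub_sub_cancel]
  have hupper := sum_orderStatExp_le h (Nat.le_mul_of_pos_right k hs) ht
  have hlower := integral_indicator_mul_geom_sum_le h (hF.ae_nonneg hμ ha) hs t
  have hmax : ∫ x, max (x - t) 0 ∂μ = (∫ x in Set.Ioi t, x ∂μ) - t / s := by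
    have e : (fun x => max (x - t) 0) = (Set.Ioi t).indicator fun x => x - t := by
      ext x
      by_cases hx : t < x
      · simp [hx, hx.le]
      · simp [hx, not_lt.1 hx]
    rw [e, integral_indicator measurableSet_Ioi, integral_sub (f := fun x => x)
      (Integrable.integrableOn h) (integrable_const t).integrableOn, setIntegral_const, hIoi,
      smul_eq_mul, one_div_mul_eq_div]
  have hI : 0 ≤ ∫ x in Set.Ioi t, x ∂μ :=
    setIntegral_nonneg measurableSet_Ioi fun x hx => ht.trans (le_of_lt hx)
  have hgeom : (s : ℝ) * (1 - 1 / Real.exp 1) ≤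
      ∑ i ∈ Finset.range s, (1 - 1 / (s : ℝ)) ^ i := by
    have h1 := Real.one_sub_div_pow_le_exp_neg (n := s) (t := 1) hs1
    have h2 := geom_sum_mul (1 - 1 / (s : ℝ)) s
    have h3 : ∑ i ∈ Finset.range s, (1 - 1 / (s : ℝ)) ^ i = s * (1 - (1 - 1 / (s : ℝ)) ^ s) := by
      field_simp at h2 ⊢
      linarith
    rw [h3, one_div, ← Real.exp_neg]
    exact mul_le_mul_of_nonneg_left (by linarith) hs0.le
  rw [hIic] at hlower
  have he : 0 ≤ 1 - 1 / Real.exp 1 :=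
    sub_nonneg.2 ((div_le_one (Real.exp_pos 1)).2 (Real.one_le_exp zero_le_one))
  calc (1 - 1 / Real.exp 1) * ∑ j ∈ Finset.Icc 1 k, orderStatExp μ j (k * s)
      ≤ (1 - 1 / Real.exp 1) * (k * s * ∫ x in Set.Ioi t, x ∂μ) := by
        refine mul_le_mul_of_nonneg_left (hupper.trans (le_of_eq ?_)) he
        rw [hmax]
        push_cast
        field_simp
        ring
    _ = k * ((∫ x in Set.Ioi t, x ∂μ) * (s * (1 - 1 / Real.exp 1))) := by ring
    _ ≤ k * orderStatExp μ 1 s :=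
        mul_le_mul_of_nonneg_left ((mul_le_mul_of_nonneg_left hgeom hI).trans hlower)
          (Nat.cast_nonneg k)

end Welfare

theorem stmt19 (lam : ℝ) (hlam : lam ∈ Set.Ico (0:ℝ) 1)
    (F f : ℝ → ℝ) (a : ℝ) (b : EReal) (ha : 0 ≤ a)
    (μ : Measure ℝ)
    (hF : IsCDF F f a b) (hμ : InducedBy μ F a b)
    (hreg : LambdaRegular lam F f a b)
    (n k : ℕ) (hk : 1 ≤ k) (hkn : k ≤ n) (hdvd : k ∣ n)
    (hint : Integrable (orderStat n 1) (Measure.pi fun _ : Fin n => μ))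
    (s : ℕ) (hs : s = n / k)
    (p : ℝ) (hp : p = orderStatExp μ 1 s) :
    (k : ℝ) * p * (1 - (F p) ^ s) ≥
      cReg lam * (1 - 1 / Real.exp 1) * ∑ j ∈ Finset.Icc 1 k, orderStatExp μ j n := by
  have := hμ.1
  obtain ⟨m, rfl⟩ := hdvd
  have hsm : s = m := by rw [hs, Nat.mul_div_cancel_left m hk]
  subst hsm
  have hs1 : 1 ≤ s := Nat.pos_of_ne_zero fun h0 => by subst h0; omega
  have hid := hF.integrable_id hμ ha (hk.trans hkn) hint
  have hmax := integrable_orderStat_one hid hs1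
  have hc := hreg.cReg_le_one_sub_pow_mean hlam.1 hlam.2 hF hμ hs1 hmax
  have hw := hF.sum_orderStatExp_le_mul hμ ha hid (k := k) hs1
  have hp0 : 0 ≤ orderStatExp μ 1 s := ha.trans (hF.orderStatExp_mem hμ hs1 hmax).1.le
  have hc0 : 0 ≤ cReg lam := by
    unfold cReg
    split_ifs
    · positivity
    · exact Real.rpow_nonneg (sub_nonneg.2 hlam.2.le) _
  rw [hp, ge_iff_le, mul_assoc]
  calc cReg lam * ((1 - 1 / Real.exp 1) * ∑ j ∈ Finset.Icc 1 k, orderStatExp μ j (k * s))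
      ≤ cReg lam * (k * orderStatExp μ 1 s) := mul_le_mul_of_nonneg_left hw hc0
    _ ≤ (1 - F (orderStatExp μ 1 s) ^ s) * (k * orderStatExp μ 1 s) :=
        mul_le_mul_of_nonneg_right hc (by positivity)
    _ = k * orderStatExp μ 1 s * (1 - F (orderStatExp μ 1 s) ^ s) := by ring
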